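/- arXiv:2509.16561 — 2 statements merged into one kernel-verified Lean document; each statement's English description precedes it below -/
import Mathlib

section
/- Let N be a finite set of n ≥ 1 players, let v : 𝒫(N) → ℝ be a value function, let i ∈ N, and let m ≥ 1. For each order r ∈ {0, …, n−1} and each sample index t ∈ {1, …, m}, let S_t^r be a random subset of N \ {i} distributed uniformly over the subsets of N \ {i} of cardinality r. Then the stratified sampling estimator φ̂(i) = (1/n) · Σ_{r=0}^{n−1} (1/m) · Σ_{t=1}^{m} (v(S_t^r ∪ {i}) − v(S_t^r)) is unbiased: E[φ̂(i)] = φ(i), where φ(i) is the Shapley value of i. -/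
open Finset MeasureTheory ENNReal

/-- The expectation of a function of a random variable that takes values in a finite set. -/
theorem integrable_and_integral_comp_of_mem_finset {Ω β : Type*} [MeasurableSpace Ω]
    (P : Measure Ω) [IsFiniteMeasure P] (F : Finset β) (X : Ω → β)
    (hX : ∀ b, MeasurableSet {ω | X ω = b}) (hF : ∀ ω, X ω ∈ F) (f : β → ℝ) :
    Integrable (fun ω => f (X ω)) P ∧
      ∫ ω, f (X ω) ∂P = ∑ b ∈ F, P.real {ω | X ω = b} * f b := by
  classical
  have hf : (fun ω => f (X ω)) =
      fun ω => ∑ b ∈ F, {ω | X ω = b}.indicator (fun _ => f b) ω := by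
    funext ω
    simp [Set.indicator_apply, hF ω]
  have hint : ∀ b ∈ F, Integrable ({ω | X ω = b}.indicator (fun _ => f b)) P :=
    fun b _ => (integrable_const _).indicator (hX b)
  rw [hf]
  refine ⟨integrable_finsetSum _ hint, ?_⟩
  rw [integral_finsetSum _ hint]
  refine Finset.sum_congr rfl fun b _ => ?_
  rw [integral_indicator_const _ (hX b), smul_eq_mul]

/-- The Shapley weight is the probability of drawing a coalition by first choosing its size
uniformly, then the coalition uniformly among those of that size. -/
theorem one_div_mul_inv_choose_eq_factorial {n r : ℕ} (hr : r < n) :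
    1 / (n : ℝ) * ((n - 1).choose r : ℝ)⁻¹ =
      (r.factorial : ℝ) * ((n - r - 1).factorial : ℝ) / (n.factorial : ℝ) := by
  obtain ⟨k, rfl⟩ : ∃ k, n = r + k + 1 := ⟨n - r - 1, by omega⟩
  have h1 : r + k + 1 - 1 = r + k := by omega
  have h2 : r + k + 1 - r - 1 = k := by omega
  rw [h1, h2, Nat.cast_add_choose, Nat.factorial_succ]
  have := Nat.factorial_ne_zero r
  have := Nat.factorial_ne_zero k
  have := Nat.factorial_ne_zero (r + k)
  push_cast
  field_simp

/-- Unbiasedness of the SalaMA stratified sampling estimator: if, for each order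
`r ∈ {0, …, n−1}` and sample index `t ∈ {1, …, m}`, the random subset `S r t` is
uniformly distributed over the size-`r` subsets of `N \ {i}`, then the expectation of
`φ̂(i) = (1/n) · Σ_{r=0}^{n−1} (1/m) · Σ_{t=1}^{m} (v(S_t^r ∪ {i}) − v(S_t^r))`
equals the Shapley value
`φ(i) = Σ_{S ⊆ N \ {i}} (|S|! · (n − |S| − 1)! / n!) · (v(S ∪ {i}) − v(S))`. -/
theorem salama_estimator_unbiased {α : Type*} [DecidableEq α]
    {Ω : Type*} [MeasurableSpace Ω] (P : Measure Ω) [IsProbabilityMeasure P]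
    (N : Finset α) (n : ℕ) (hn : N.card = n) (hn1 : 1 ≤ n)
    (v : Finset α → ℝ) (i : α) (hi : i ∈ N)
    (m : ℕ) (hm : 1 ≤ m)
    (S : ℕ → ℕ → Ω → Finset α)
    (hmeas : ∀ r t (A : Finset α), MeasurableSet {ω | S r t ω = A})
    (hval : ∀ r < n, ∀ t < m, ∀ ω, S r t ω ⊆ N.erase i ∧ (S r t ω).card = r)
    (hunif : ∀ r < n, ∀ t < m, ∀ A ⊆ N.erase i, A.card = r →
      P {ω | S r t ω = A} = (((n - 1).choose r : ℝ≥0∞))⁻¹) :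
    ∫ ω, (1 / (n : ℝ)) * ∑ r ∈ Finset.range n, (1 / (m : ℝ)) *
          ∑ t ∈ Finset.range m, (v (insert i (S r t ω)) - v (S r t ω)) ∂P
      = ∑ T ∈ (N.erase i).powerset,
          ((T.card.factorial : ℝ) * ((n - T.card - 1).factorial : ℝ) / (n.factorial : ℝ))
            * (v (insert i T) - v T) := by
  have hcard : (N.erase i).card = n - 1 := by rw [Finset.card_erase_of_mem hi, hn]
  have hS : ∀ r ∈ Finset.range n, ∀ t ∈ Finset.range m,
      Integrable (fun ω => v (insert i (S r t ω)) - v (S r t ω)) P ∧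
      ∫ ω, (v (insert i (S r t ω)) - v (S r t ω)) ∂P =
        ∑ A ∈ (N.erase i).powersetCard r,
          ((n - 1).choose r : ℝ)⁻¹ * (v (insert i A) - v A) := by
    intro r hr t ht
    rw [Finset.mem_range] at hr ht
    obtain ⟨h1, h2⟩ := integrable_and_integral_comp_of_mem_finset P
      ((N.erase i).powersetCard r) (S r t) (hmeas r t)
      (fun ω => Finset.mem_powersetCard.2 (hval r hr t ht ω))
      (fun A => v (insert i A) - v A)
    refine ⟨h1, h2.trans (Finset.sum_congr rfl fun A hA => ?_)⟩
    obtain ⟨hA1, hA2⟩ := Finset.mem_powersetCard.1 hA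
    rw [measureReal_def, hunif r hr t ht A hA1 hA2, ENNReal.toReal_inv, ENNReal.toReal_natCast]
  have hm0 : (m : ℝ) ≠ 0 := by positivity
  rw [integral_const_mul, integral_finsetSum _ fun r hr =>
      (integrable_finsetSum _ fun t ht => (hS r hr t ht).1).const_mul _,
    Finset.sum_powerset, hcard, Nat.sub_add_cancel hn1, Finset.mul_sum]
  refine Finset.sum_congr rfl fun r hr => ?_
  rw [integral_const_mul, integral_finsetSum _ fun t ht => (hS r hr t ht).1,
    Finset.sum_congr rfl fun t ht => (hS r hr t ht).2, Finset.sum_const, Finset.card_range,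
    nsmul_eq_mul, ← mul_assoc (1 / (m : ℝ)), one_div_mul_cancel hm0, one_mul, Finset.mul_sum]
  refine Finset.sum_congr rfl fun A hA => ?_
  rw [(Finset.mem_powersetCard.1 hA).2, ← mul_assoc,
    one_div_mul_inv_choose_eq_factorial (Finset.mem_range.1 hr)]
end

section
/- Let X₁, …, Xₙ be bounded random variables taking values in {0, 1} and ε₁, …, εₙ bounded random variables on a common probability space, let δ₊, δ₋ ∈ ℝ and λ > −1, and define μᵢ = δ₊ · Xᵢ + δ₋ · (1 − Xᵢ) + εᵢ for each i, Perf = Σ_{i=1}^n μᵢ, and CoSP = (1+λ) · Σ_{i=1}^n Xᵢ − nλ. Assume Cov(μᵢ, Xⱼ) = 0 whenever i ≠ j, and Cov(εᵢ, Xᵢ) = 0 for every i. Then Cov(Perf, CoSP) = (1+λ) · (δ₊ − δ₋) · Σ_{i=1}^n Var(Xᵢ). -/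
open MeasureTheory

/-- The covariance `Cov(Y, Z) = E[YZ] − E[Y]E[Z]` of two real random variables. -/
noncomputable def cov {Ω : Type*} [MeasurableSpace Ω] (P : Measure Ω)
    (Y Z : Ω → ℝ) : ℝ :=
  (∫ ω, Y ω * Z ω ∂P) - (∫ ω, Y ω ∂P) * (∫ ω, Z ω ∂P)

/-- The product formula for the covariance agrees with Mathlib's centred definition on `L²`. -/
lemma cov_eq_covariance {Ω : Type*} [MeasurableSpace Ω] {P : Measure Ω}
    [IsProbabilityMeasure P] {Y Z : Ω → ℝ} (hY : MemLp Y 2 P) (hZ : MemLp Z 2 P) :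
    cov P Y Z = ProbabilityTheory.covariance Y Z P :=
  (ProbabilityTheory.covariance_eq_sub hY hZ).symm

/-- Covariance between performance and CoSP: with `μᵢ = δ₊·Xᵢ + δ₋·(1−Xᵢ) + εᵢ`,
`Perf = Σᵢ μᵢ`, `CoSP = (1+λ)·Σᵢ Xᵢ − nλ`, `Cov(μᵢ, Xⱼ) = 0` for `i ≠ j` and
`Cov(εᵢ, Xᵢ) = 0` for all `i`, one has
`Cov(Perf, CoSP) = (1+λ) · (δ₊ − δ₋) · Σᵢ Var(Xᵢ)`. -/
theorem cov_perf_cosp {Ω : Type*} [MeasurableSpace Ω] (P : Measure Ω)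
    [IsProbabilityMeasure P] (n : ℕ) (X ε : Fin n → Ω → ℝ) (δp δm lam : ℝ)
    (hlam : -1 < lam)
    (hXmeas : ∀ i, Measurable (X i)) (hεmeas : ∀ i, Measurable (ε i))
    (hX01 : ∀ i ω, X i ω = 0 ∨ X i ω = 1)
    (hεbdd : ∀ i, ∃ C : ℝ, ∀ ω, |ε i ω| ≤ C)
    (μ : Fin n → Ω → ℝ)
    (hμ : ∀ i ω, μ i ω = δp * X i ω + δm * (1 - X i ω) + ε i ω)
    (hcross : ∀ i j, i ≠ j → cov P (μ i) (X j) = 0)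
    (hres : ∀ i, cov P (ε i) (X i) = 0) :
    cov P (fun ω => ∑ i, μ i ω) (fun ω => (1 + lam) * ∑ i, X i ω - n * lam)
      = (1 + lam) * (δp - δm) * ∑ i, cov P (X i) (X i) := by
  have hX : ∀ i, MemLp (X i) 2 P := fun i ↦
    MemLp.of_bound (hXmeas i).aestronglyMeasurable 1 <| ae_of_all _ fun ω ↦ by
      rcases hX01 i ω with h | h <;> simp [h]
  have hε : ∀ i, MemLp (ε i) 2 P := fun i ↦ by
    obtain ⟨C, hC⟩ := hεbdd i
    exact MemLp.of_bound (hεmeas i).aestronglyMeasurable C (ae_of_all _ hC)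
  have hdX : ∀ i, MemLp (fun ω ↦ (δp - δm) * X i ω) 2 P := fun i ↦ (hX i).const_mul _
  have hdXε : ∀ i, MemLp (fun ω ↦ (δp - δm) * X i ω + ε i ω) 2 P := fun i ↦
    (hdX i).add (hε i)
  have hμ_eq : ∀ i, μ i = fun ω ↦ ((δp - δm) * X i ω + ε i ω) + δm := fun i ↦ by
    ext ω
    rw [hμ]
    ring
  have hμL : ∀ i, MemLp (μ i) 2 P := fun i ↦ by
    rw [hμ_eq]
    exact (hdXε i).add (memLp_const δm)
  have hdiag : ∀ i, cov P (μ i) (X i) = (δp - δm) * cov P (X i) (X i) := fun i ↦ by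
    have h := hres i
    rw [cov_eq_covariance (hε i) (hX i)] at h
    rw [cov_eq_covariance (hμL i) (hX i), cov_eq_covariance (hX i) (hX i), hμ_eq,
      ProbabilityTheory.covariance_add_const_left ((hdXε i).integrable one_le_two)]
    have hadd := ProbabilityTheory.covariance_add_left (hdX i) (hε i) (hX i)
    rw [ProbabilityTheory.covariance_const_mul_left, h, add_zero] at hadd
    exact hadd
  have hsumX : MemLp (fun ω ↦ ∑ i, X i ω) 2 P := memLp_finsetSum _ fun i _ ↦ hX i
  have hsumμ : MemLp (fun ω ↦ ∑ i, μ i ω) 2 P := memLp_finsetSum _ fun i _ ↦ hμL i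
  have hscaled : MemLp (fun ω ↦ (1 + lam) * ∑ i, X i ω) 2 P := hsumX.const_mul _
  have hCoSP : MemLp (fun ω ↦ (1 + lam) * ∑ i, X i ω - n * lam) 2 P :=
    hscaled.sub (memLp_const _)
  have hrow : ∀ i, ∑ j, ProbabilityTheory.covariance (μ i) (X j) P
      = (δp - δm) * cov P (X i) (X i) := fun i ↦ by
    rw [← hdiag, Finset.sum_eq_single i, cov_eq_covariance (hμL i) (hX i)]
    · intro j _ hj
      rw [← cov_eq_covariance (hμL i) (hX j), hcross i j hj.symm]
    · simp
  rw [cov_eq_covariance hsumμ hCoSP,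
    ProbabilityTheory.covariance_sub_const_right (hscaled.integrable one_le_two),
    ProbabilityTheory.covariance_const_mul_right,
    ProbabilityTheory.covariance_fun_sum_fun_sum hμL hX, Finset.sum_congr rfl fun i _ ↦ hrow i,
    ← Finset.mul_sum, mul_assoc]
end
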